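/- Let S be a non-ordinary almost symmetric numerical semigroup. Then A*(S) = S ∪ PF(S) is an almost symmetric numerical semigroup if and only if the numerical semigroup S ∪ {F(S)} has maximal embedding dimension. -/

import Mathlib

open scoped Classical

/-- A numerical set: a subset of ℕ containing 0 with finite complement. -/
def NumericalSet (H : Set ℕ) : Prop := 0 ∈ H ∧ Hᶜ.Finite

/-- A numerical semigroup: a numerical set closed under addition. -/
def NumericalSemigroup (S : Set ℕ) : Prop :=
  NumericalSet S ∧ ∀ a ∈ S, ∀ b ∈ S, a + b ∈ S

/-- Frobenius number: the largest gap. -/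
noncomputable def frob (H : Set ℕ) : ℕ := sSup Hᶜ

/-- Genus: the number of gaps. -/
noncomputable def genus (H : Set ℕ) : ℕ := Hᶜ.ncard

/-- Multiplicity: the smallest nonzero element. -/
noncomputable def mult (H : Set ℕ) : ℕ := sInf {x | x ∈ H ∧ x ≠ 0}

/-- The T-set of a numerical set.  (With truncated subtraction, every `x ≥ frob H`
satisfies `frob H - x = 0`, matching the convention that `F(H) - x` computed in ℤ
is nonpositive, hence not a nonzero element of `H`.) -/
def Tset (H : Set ℕ) : Set ℕ := {x | frob H - x ∉ H ∨ frob H - x = 0}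

/-- The associated numerical semigroup of a numerical set. -/
def A (H : Set ℕ) : Set ℕ := {x | ∀ h ∈ H, x + h ∈ H}

/-- `A*`-operation on numerical sets. -/
def Astar (H : Set ℕ) : Set ℕ := {a | ∀ h ∈ H, h ≠ 0 → a + h ∈ H}

/-- Pseudo-Frobenius numbers of a numerical set. -/
def PF (H : Set ℕ) : Set ℕ := {a | a ∉ H ∧ ∀ h ∈ H, h ≠ 0 → a + h ∈ H}

/-- Type of a numerical set. -/
noncomputable def typ (H : Set ℕ) : ℕ := (PF H).ncard

/-- Almost symmetric: `t(S) = 2 g(S) - F(S)`. -/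
def AlmostSymmetric (S : Set ℕ) : Prop :=
  (typ S : ℤ) = 2 * (genus S : ℤ) - (frob S : ℤ)

/-- An ordinary numerical set: `{0} ∪ {x : x > F(H)}`. -/
def Ordinary (H : Set ℕ) : Prop := H = insert 0 {x : ℕ | frob H < x}

/-- Embedding dimension: number of minimal generators. -/
noncomputable def embdim (S : Set ℕ) : ℕ :=
  ((S \ {0}) \ {x | ∃ a ∈ S \ ({0} : Set ℕ), ∃ b ∈ S \ ({0} : Set ℕ), x = a + b}).ncard

/-- Maximal embedding dimension. -/
def MaxEmbDim (S : Set ℕ) : Prop := embdim S = mult S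

/-- The Frobenius number is characterised as a gap above which there are no gaps. -/
theorem frob_eq_of_forall_lt {H : Set ℕ} {F : ℕ} (hF : F ∉ H) (hlt : ∀ x, F < x → x ∈ H) :
    frob H = F := by
  have : IsGreatest Hᶜ F := ⟨hF, fun x hx => by
    by_contra hc
    exact hx (hlt x (by omega))⟩
  exact this.csSup_eq

theorem mem_of_frob_lt {H : Set ℕ} (hfin : Hᶜ.Finite) {x : ℕ} (hx : frob H < x) : x ∈ H := by
  by_contra hc
  have : x ≤ frob H := le_csSup hfin.bddAbove hc
  omega

theorem frob_notMem {H : Set ℕ} (hfin : Hᶜ.Finite) (hne : Hᶜ.Nonempty) : frob H ∉ H :=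
  Nat.sSup_mem hne hfin.bddAbove

theorem mult_spec {H : Set ℕ} (hfin : Hᶜ.Finite) :
    (mult H ∈ H ∧ mult H ≠ 0) ∧ ∀ x ∈ H, x ≠ 0 → mult H ≤ x :=
  ⟨Nat.sInf_mem (s := {x | x ∈ H ∧ x ≠ 0})
    ⟨frob H + 1, mem_of_frob_lt hfin (Nat.lt_succ_self _), Nat.succ_ne_zero _⟩,
    fun _ hx h0 => Nat.sInf_le ⟨hx, h0⟩⟩

/-- A proper numerical semigroup is almost symmetric exactly when every gap `x` whose
reflection `frob S - x` is again a gap is a pseudo-Frobenius number. -/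
theorem almostSymmetric_iff_forall_mem_PF {S : Set ℕ} (hS : NumericalSemigroup S)
    (hne : Sᶜ.Nonempty) :
    AlmostSymmetric S ↔ ∀ x, x ∉ S → x < frob S → frob S - x ∉ S → x ∈ PF S := by
  obtain ⟨⟨h0, hfin⟩, hadd⟩ := hS
  have hF := frob_notMem hfin hne
  have hlt : ∀ x, frob S < x → x ∈ S := fun x => mem_of_frob_lt hfin
  unfold AlmostSymmetric typ genus
  generalize frob S = F at *
  have hle : ∀ x, x ∉ S → x ≤ F := fun x hx => by
    by_contra hc
    exact hx (hlt x (by omega))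
  let G := (Finset.range (F + 1)).filter (· ∉ S)
  let N := (Finset.range (F + 1)).filter (· ∈ S)
  let R := G.filter (fun x => F - x ∈ S)
  let L := G.filter (fun x => F - x ∉ S)
  have hGN : N.card + G.card = F + 1 := by
    simpa [N, G] using Finset.card_filter_add_card_filter_not (s := Finset.range (F + 1)) (· ∈ S)
  have hRL : R.card + L.card = G.card :=
    Finset.card_filter_add_card_filter_not (s := G) (fun x => F - x ∈ S)
  have hNR : N.card = R.card := by
    apply Finset.card_bij' (fun x _ => F - x) (fun x _ => F - x)
    · intro x hx
      simp only [N, R, G, Finset.mem_filter, Finset.mem_range] at hx ⊢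
      refine ⟨⟨by omega, fun h => hF ?_⟩, ?_⟩
      · have := hadd _ hx.2 _ h
        rwa [show x + (F - x) = F by omega] at this
      · rw [show F - (F - x) = x by omega]
        exact hx.2
    · intro x hx
      simp only [N, R, G, Finset.mem_filter, Finset.mem_range] at hx ⊢
      exact ⟨by omega, hx.2⟩
    · intro x hx
      simp only [N, Finset.mem_filter, Finset.mem_range] at hx
      omega
    · intro x hx
      simp only [R, G, Finset.mem_filter, Finset.mem_range] at hx
      omega
  have hgen : Sᶜ.ncard = G.card := by
    rw [← Set.ncard_coe_finset]
    congr 1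
    ext x
    simp only [G, Set.mem_compl_iff, Finset.coe_filter, Finset.mem_range, Set.mem_ofPred_eq]
    exact ⟨fun h => ⟨by have := hle x h; omega, h⟩, fun h => h.2⟩
  have hFL : F ∉ L := by simp [L, h0]
  have hsub : PF S ⊆ ((insert F L : Finset ℕ) : Set ℕ) := by
    intro x hx
    have hxF := hle x hx.1
    by_cases hxe : x = F
    · simp [hxe]
    · simp only [Finset.coe_insert, Set.mem_insert_iff, Finset.mem_coe]
      refine Or.inr ?_
      simp only [L, G, Finset.mem_filter, Finset.mem_range]
      refine ⟨⟨by omega, hx.1⟩, fun h => hF ?_⟩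
      have := hx.2 _ h (by omega)
      rwa [show x + (F - x) = F by omega] at this
  have hcard : ((insert F L : Finset ℕ) : Set ℕ).ncard = L.card + 1 := by
    rw [Set.ncard_coe_finset, Finset.card_insert_of_notMem hFL]
  rw [hgen]
  constructor
  · intro h x hx hxF hFx
    have heq : PF S = ((insert F L : Finset ℕ) : Set ℕ) :=
      Set.eq_of_subset_of_ncard_le hsub (by omega) (Finset.finite_toSet _)
    rw [heq]
    simp only [Finset.coe_insert, Set.mem_insert_iff, Finset.mem_coe]
    refine Or.inr ?_
    simp only [L, G, Finset.mem_filter, Finset.mem_range]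
    exact ⟨⟨by omega, hx⟩, hFx⟩
  · intro h
    have heq : PF S = ((insert F L : Finset ℕ) : Set ℕ) := by
      refine hsub.antisymm fun x hx => ?_
      simp only [Finset.coe_insert, Set.mem_insert_iff, Finset.mem_coe] at hx
      rcases hx with rfl | hx
      · exact ⟨hF, fun k _ hk0 => hlt _ (by omega)⟩
      · simp only [L, G, Finset.mem_filter, Finset.mem_range] at hx
        refine h x hx.1.2 ?_ hx.2
        have : x ≠ F := by
          rintro rfl
          simp [h0] at hx
        omega
    rw [heq, hcard]
    omega

/-- A numerical semigroup has maximal embedding dimension exactly when subtracting the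
multiplicity from a sum of two nonzero elements stays in the semigroup. -/
theorem maxEmbDim_iff_forall_add_sub_mem {T : Set ℕ} (hT : NumericalSemigroup T) :
    MaxEmbDim T ↔ ∀ a ∈ T, a ≠ 0 → ∀ b ∈ T, b ≠ 0 → a + b - mult T ∈ T := by
  obtain ⟨⟨h0, hfin⟩, hadd⟩ := hT
  obtain ⟨⟨hm, hm0⟩, hmin⟩ := mult_spec hfin
  have hlt : ∀ x, frob T < x → x ∈ T := fun x => mem_of_frob_lt hfin
  unfold MaxEmbDim embdim
  generalize mult T = m at *
  generalize frob T = F at *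
  set E := (T \ {0}) \ {x | ∃ a ∈ T \ ({0} : Set ℕ), ∃ b ∈ T \ ({0} : Set ℕ), x = a + b} with hE
  have memE : ∀ x, x ∈ E ↔ (x ∈ T ∧ x ≠ 0) ∧
      ∀ a ∈ T, a ≠ 0 → ∀ b ∈ T, b ≠ 0 → x ≠ a + b := by
    intro x
    simp [hE]
  have hmul : ∀ k, m * k ∈ T := by
    intro k
    induction k with
    | zero => simpa using h0
    | succ k ih => exact hadd _ ih _ hm
  have hdiff : ∀ x y, x < y → x % m = y % m → ∃ k, y = x + m * (k + 1) := by
    intro x y hxy h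
    obtain ⟨k, hk⟩ := (Nat.modEq_iff_dvd' hxy.le).1 h
    cases k with
    | zero => omega
    | succ k => exact ⟨k, by omega⟩
  have hE_le : ∀ e ∈ E, ∀ x ∈ T, x ≠ 0 → x % m = e % m → e ≤ x := by
    intro e he x hx hx0 h
    by_contra! hc
    obtain ⟨k, hk⟩ := hdiff _ _ hc h
    exact ((memE e).1 he).2 x hx hx0 _ (hmul (k + 1)) (by positivity) hk
  have hinj : Set.InjOn (· % m) E := by
    intro x hx y hy h
    obtain ⟨⟨hxT, hx0⟩, -⟩ := (memE x).1 hx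
    obtain ⟨⟨hyT, hy0⟩, -⟩ := (memE y).1 hy
    exact le_antisymm (hE_le x hx y hyT hy0 h.symm) (hE_le y hy x hxT hx0 h)
  have himg : (· % m) '' E ⊆ ((Finset.range m : Finset ℕ) : Set ℕ) := by
    rintro _ ⟨x, -, rfl⟩
    simpa using Nat.mod_lt x (by omega)
  rw [← hinj.ncard_image]
  have hcard : ((Finset.range m : Finset ℕ) : Set ℕ).ncard = m := by
    rw [Set.ncard_coe_finset, Finset.card_range]
  constructor
  · intro h a ha ha0 b hb hb0
    have heq := Set.eq_of_subset_of_ncard_le himg (by omega) (Finset.finite_toSet _)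
    have : (a + b) % m ∈ (· % m) '' E := by
      rw [heq]
      simpa using Nat.mod_lt _ (by omega)
    obtain ⟨e, he, hmod⟩ := this
    have hle := hE_le e he (a + b) (hadd a ha b hb) (by omega) hmod.symm
    have hne : e ≠ a + b := ((memE e).1 he).2 a ha ha0 b hb hb0
    obtain ⟨k, hk⟩ := hdiff e (a + b) (by omega) hmod
    rw [show a + b - m = e + m * k by rw [hk, mul_add]; omega]
    exact hadd _ ((memE e).1 he).1.1 _ (hmul k)
  · intro h
    suffices heq : (· % m) '' E = ((Finset.range m : Finset ℕ) : Set ℕ) by rw [heq, hcard]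
    refine himg.antisymm fun r hr => ?_
    have hr : r < m := by simpa using hr
    have hex : ∃ x, x ∈ T ∧ x ≠ 0 ∧ x % m = r := by
      have : F + 1 ≤ m * (F + 1) := Nat.le_mul_of_pos_left _ (by omega)
      refine ⟨r + m * (F + 1), hlt _ (by omega), by omega, ?_⟩
      rw [Nat.add_mul_mod_self_left, Nat.mod_eq_of_lt hr]
    obtain ⟨heT, he0, her⟩ := Nat.find_spec hex
    refine ⟨Nat.find hex, (memE _).2 ⟨⟨heT, he0⟩, fun a ha ha0 b hb hb0 hab => ?_⟩, her⟩
    have hma := hmin a ha ha0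
    have hmb := hmin b hb hb0
    refine Nat.find_min hex (m := a + b - m) (by omega) ⟨h a ha ha0 b hb hb0, by omega, ?_⟩
    rw [← Nat.mod_eq_sub_mod (by omega), ← hab, her]

theorem NumericalSemigroup.union_PF {S : Set ℕ} (hS : NumericalSemigroup S) :
    NumericalSemigroup (S ∪ PF S) := by
  obtain ⟨⟨h0, hfin⟩, hadd⟩ := hS
  refine ⟨⟨Or.inl h0, hfin.subset (Set.compl_subset_compl.2 Set.subset_union_left)⟩, ?_⟩
  have key : ∀ a ∈ S ∪ PF S, ∀ h ∈ S, h ≠ 0 → a + h ∈ S := by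
    rintro a (ha | ha) h hh hh0
    exacts [hadd a ha h hh, ha.2 h hh hh0]
  intro a ha b hb
  by_cases hab : a + b ∈ S
  · exact Or.inl hab
  · refine Or.inr ⟨hab, fun h hh hh0 => ?_⟩
    rw [add_assoc]
    exact key a ha _ (key b hb h hh hh0) (by omega)

theorem NumericalSemigroup.insert_frob {S : Set ℕ} (hS : NumericalSemigroup S) :
    NumericalSemigroup (insert (frob S) S) := by
  obtain ⟨⟨h0, hfin⟩, hadd⟩ := hS
  refine ⟨⟨Or.inr h0, hfin.subset (Set.compl_subset_compl.2 (Set.subset_insert _ _))⟩, ?_⟩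
  have key : ∀ a, frob S + a ∈ insert (frob S) S := by
    intro a
    rcases Nat.eq_zero_or_pos a with rfl | ha
    · exact Or.inl rfl
    · exact Or.inr (mem_of_frob_lt hfin (by omega))
  rintro a (rfl | ha) b (rfl | hb)
  · exact key _
  · exact key _
  · rw [add_comm]
    exact key _
  · exact Or.inr (hadd a ha b hb)

theorem stmt_13 (S : Set ℕ) (hS : NumericalSemigroup S) (hAS : AlmostSymmetric S)
    (hord : ¬ Ordinary S) :
    (NumericalSemigroup (S ∪ PF S) ∧ AlmostSymmetric (S ∪ PF S)) ↔
      MaxEmbDim (insert (frob S) S) := by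
  have hS' := hS.union_PF
  have hT := hS.insert_frob
  have ⟨⟨h0, hfin⟩, hadd⟩ := hS
  have hne : Sᶜ.Nonempty := by
    by_contra hc
    have hSu : S = Set.univ := by simpa [Set.not_nonempty_iff_eq_empty] using hc
    refine hord ?_
    subst hSu
    ext x
    simp [frob]
    omega
  rw [almostSymmetric_iff_forall_mem_PF hS hne] at hAS
  have hF := frob_notMem hfin hne
  have hlt : ∀ x, frob S < x → x ∈ S := fun x => mem_of_frob_lt hfin
  obtain ⟨⟨hm, hm0⟩, hmin⟩ := mult_spec hfin
  have hmF : mult S < frob S := by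
    by_contra hc
    have hmF' : mult S ≠ frob S := fun h => hF (h ▸ hm)
    refine hord (Set.ext fun x => ⟨fun hx => ?_, ?_⟩)
    · by_cases hx0 : x = 0
      · exact Or.inl hx0
      · have := hmin x hx hx0
        exact Or.inr (show frob S < x by omega)
    · rintro (rfl | hx)
      exacts [h0, hlt x hx]
  have hmultT : mult (insert (frob S) S) = mult S := by
    obtain ⟨⟨h1, h2⟩, h3⟩ := mult_spec hT.1.2
    refine le_antisymm (h3 _ (Or.inr hm) hm0) ?_
    rcases h1 with h1 | h1
    · omega
    · exact hmin _ h1 h2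
  -- Elements of `S ∪ PF S` below the Frobenius number are the reflections of gaps.
  have mem_union : ∀ x, x < frob S → 0 < x → (x ∈ S ∪ PF S ↔ frob S - x ∉ S) := by
    intro x hxF hx0
    constructor
    · rintro (hx | hx) hc
      · have := hadd _ hx _ hc
        rw [show x + (frob S - x) = frob S by omega] at this
        exact hF this
      · have := hx.2 _ hc (by omega)
        rw [show x + (frob S - x) = frob S by omega] at this
        exact hF this
    · intro h
      by_cases hx : x ∈ S
      · exact Or.inl hx
      · exact Or.inr (hAS x hx hxF h)
  have union_add : ∀ a ∈ S ∪ PF S, ∀ h ∈ S, h ≠ 0 → a + h ∈ S := by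
    rintro a (ha | ha) h hh hh0
    exacts [hadd a ha h hh, ha.2 h hh hh0]
  have hge : ∀ x, frob S ≤ x → x ∈ S ∪ PF S := by
    intro x hx
    by_cases hxF : x = frob S
    · exact Or.inr ⟨hxF ▸ hF, fun h _ hh0 => hlt _ (by omega)⟩
    · exact Or.inl (hlt x (by omega))
  have hgap : frob S - mult S ∉ S ∪ PF S := by
    rw [mem_union _ (by omega) (by omega), not_not, Nat.sub_sub_self hmF.le]
    exact hm
  have hfrob : frob (S ∪ PF S) = frob S - mult S := by
    refine frob_eq_of_forall_lt hgap fun x hx => ?_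
    by_cases hxF : frob S ≤ x
    · exact hge x hxF
    · rw [mem_union x (by omega) (by omega)]
      intro hc
      have := hmin _ hc (by omega)
      omega
  rw [and_iff_right hS', almostSymmetric_iff_forall_mem_PF hS' ⟨_, hgap⟩, hfrob,
    maxEmbDim_iff_forall_add_sub_mem hT, hmultT]
  generalize mult S = m at *
  generalize frob S = F at *
  constructor
  · intro H
    have main : ∀ a ∈ S, a ≠ 0 → ∀ b ∈ S, b ≠ 0 → a + b - m ∈ insert F S := by
      intro a ha ha0 b hb hb0
      by_contra hc
      have hma := hmin a ha ha0
      have hmb := hmin b hb hb0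
      obtain ⟨hcF, hcS⟩ : a + b - m ≠ F ∧ a + b - m ∉ S := by simpa using hc
      have hcl : a + b - m < F := by
        by_contra hcl
        exact hcS (hlt _ (by omega))
      have ham : a ≠ m := by
        rintro rfl
        exact hcS (by simpa using hb)
      obtain ⟨h, hh⟩ : ∃ h, h = F - (a + b - m) := ⟨_, rfl⟩
      have hhS : h ∈ S ∪ PF S := by
        rw [mem_union h (by omega) (by omega), show F - h = a + b - m by omega]
        exact hcS
      have hs : b + h ∈ S := by
        rw [add_comm]
        exact union_add h hhS b hb hb0
      have hx : a - m ∉ S ∪ PF S := by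
        rw [mem_union _ (by omega) (by omega), not_not, show F - (a - m) = b + h by omega]
        exact hs
      have hsF : F - (b + h) ∉ S ∪ PF S := by rwa [show F - (b + h) = a - m by omega]
      have hbhm : b + h ≠ m := by omega
      have hx2 : F - m - (F - (b + h)) ∉ S ∪ PF S := by
        rw [mem_union _ (by omega) (by omega), not_not,
          show F - (F - m - (F - (b + h))) = a by omega]
        exact ha
      have hPF := H _ hsF (by omega) hx2
      have := hPF.2 h hhS (by omega)
      rw [mem_union _ (by omega) (by omega), show F - (F - (b + h) + h) = b by omega] at this
      exact this hb
    have mainF : ∀ b ∈ insert F S, b ≠ 0 → F + b - m ∈ insert F S := by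
      intro b hb hb0
      have hmb : m ≤ b := by
        rcases hb with rfl | hb
        exacts [hmF.le, hmin b hb hb0]
      rcases Nat.eq_or_lt_of_le (show F ≤ F + b - m by omega) with h | h
      · exact Or.inl h.symm
      · exact Or.inr (hlt _ h)
    rintro a (rfl | ha) ha0 b hb hb0
    · exact mainF b hb hb0
    · rcases hb with rfl | hb
      · rw [add_comm]
        exact mainF a (Or.inr ha) ha0
      · exact main a ha ha0 b hb hb0
  · intro H x hx hxF hx2
    have hx0 : x ≠ 0 := by
      rintro rfl
      exact hx (Or.inl h0)
    refine ⟨hx, fun h hh hh0 => ?_⟩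
    have ht : x + m ∈ S := by
      rwa [mem_union _ (by omega) (by omega), not_not, show F - (F - m - x) = x + m by omega] at hx2
    by_cases hxh : F ≤ x + h
    · exact hge _ hxh
    rw [mem_union _ (by omega) (by omega)]
    intro hk
    have hkx : F - (x + h) + (x + m) - m ∈ insert F S :=
      H _ (Or.inr hk) (by omega) _ (Or.inr ht) (by omega)
    rw [show F - (x + h) + (x + m) - m = F - h by omega] at hkx
    rcases hkx with hkx | hkx
    · omega
    · have := union_add h hh _ hkx (by omega)
      rw [show h + (F - h) = F by omega] at this
      exact hF this
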